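/- Fix an integer n ≥ 1. As ℓ → +∞, one has log p(n,ℓ) = ℓ·H_{n-1} + o(ℓ), where H_{n-1} = 1 + 1/2 + ⋯ + 1/(n-1) (and H₀ = 0); i.e. the sequence (log p(n,ℓ))/ℓ converges to H_{n-1} as ℓ → +∞. -/

import Mathlib

open Filter

/-- `p n ℓ` is the least common multiple of the multinomial coefficients
`ℓ! / (i₁! ⋯ iₙ!)` over all tuples `(i₁, …, iₙ) ∈ ℕⁿ` with `i₁ + ⋯ + iₙ = ℓ`. -/
def multinomialLcm (n ℓ : ℕ) : ℕ :=
  (Finset.Nat.antidiagonalTuple n ℓ).lcm (fun i => Nat.multinomial Finset.univ i)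

open MeasureTheory Set Complex in
/-- The Fejér kernel is the Fourier transform of the triangle function. -/
theorem integral_triangle_mul_cexp (v : ℝ) :
    ∫ t in (-1 : ℝ)..1, ((1 - |t| : ℝ) : ℂ) * cexp (v * t * I) =
      ((Real.sinc (v / 2) ^ 2 : ℝ) : ℂ) := by
  have hcont : Continuous fun t : ℝ => ((1 - |t| : ℝ) : ℂ) * cexp (v * t * I) := by fun_prop
  rw [← intervalIntegral.integral_add_adjacent_intervals (b := 0)
    (hcont.intervalIntegrable _ _) (hcont.intervalIntegrable _ _)]
  have hneg : ∫ t in (-1 : ℝ)..0, ((1 - |t| : ℝ) : ℂ) * cexp (v * t * I) =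
      ∫ t in (-1 : ℝ)..0, (1 + t : ℂ) * cexp (v * t * I) :=
    intervalIntegral.integral_congr fun t ht => by
      rw [uIcc_of_le (by norm_num)] at ht
      simp only [abs_of_nonpos ht.2]; push_cast; ring
  have hpos : ∫ t in (0 : ℝ)..1, ((1 - |t| : ℝ) : ℂ) * cexp (v * t * I) =
      ∫ t in (0 : ℝ)..1, (1 - t : ℂ) * cexp (v * t * I) :=
    intervalIntegral.integral_congr fun t ht => by
      rw [uIcc_of_le (by norm_num)] at ht
      simp only [abs_of_nonneg ht.1]; push_cast; ring
  rw [hneg, hpos]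
  rcases eq_or_ne v 0 with rfl | hv
  · have h1 : ∫ t in (-1 : ℝ)..0, (1 + t : ℂ) = ((∫ t in (-1 : ℝ)..0, (1 + t) : ℝ) : ℂ) := by
      rw [← intervalIntegral.integral_ofReal]; simp
    have h2 : ∫ t in (0 : ℝ)..1, (1 - t : ℂ) = ((∫ t in (0 : ℝ)..1, (1 - t) : ℝ) : ℂ) := by
      rw [← intervalIntegral.integral_ofReal]; simp
    simp only [ofReal_zero, zero_mul, Complex.exp_zero, mul_one, h1, h2]
    rw [intervalIntegral.integral_add (by simp) (by simp),
      intervalIntegral.integral_sub (by simp) (by simp)]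
    simp
    norm_num
  have hw : (v * I : ℂ) ≠ 0 := mul_ne_zero (ofReal_ne_zero.2 hv) I_ne_zero
  set w : ℂ := v * I with hwdef
  have hexp (t : ℝ) : HasDerivAt (fun t : ℝ => cexp (w * t)) (cexp (w * t) * w) t := by
    have := ((hasDerivAt_id (t : ℂ)).const_mul w).cexp.comp_ofReal
    simpa using this
  have hid (t : ℝ) : HasDerivAt (fun t : ℝ => (t : ℂ)) 1 t := (hasDerivAt_id (t : ℂ)).comp_ofReal
  have hrew (t : ℝ) : (v * t * I : ℂ) = w * t := by rw [hwdef]; ring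
  simp_rw [hrew]
  rw [intervalIntegral.integral_eq_sub_of_hasDerivAt (a := -1) (b := 0)
      (f := fun t : ℝ => (1 + t : ℂ) * cexp (w * t) / w - cexp (w * t) / w ^ 2)
      (fun t _ => by
        convert! ((((hid t).const_add 1).mul (hexp t)).div_const w).sub
          ((hexp t).div_const (w ^ 2)) using 1
        field_simp; ring)
      (Continuous.intervalIntegrable (by fun_prop) _ _),
    intervalIntegral.integral_eq_sub_of_hasDerivAt (a := 0) (b := 1)
      (f := fun t : ℝ => (1 - t : ℂ) * cexp (w * t) / w + cexp (w * t) / w ^ 2)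
      (fun t _ => by
        convert! ((((hid t).const_sub 1).mul (hexp t)).div_const w).add
          ((hexp t).div_const (w ^ 2)) using 1
        field_simp; ring)
      (Continuous.intervalIntegrable (by fun_prop) _ _)]
  have hv2 : v / 2 ≠ 0 := by positivity
  rw [Real.sinc_of_ne_zero hv2]
  have hcos : cexp w + cexp (-w) = 2 * Real.cos v := by
    rw [ofReal_cos, Complex.two_cos]
    simp [hwdef]
  have hcos2 : (Real.cos v : ℂ) = 1 - 2 * Real.sin (v / 2) ^ 2 := by
    have : Real.cos v = 1 - 2 * Real.sin (v / 2) ^ 2 := by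
      rw [← Real.cos_sq_add_sin_sq (v/2)]
      conv_lhs => rw [show v = 2 * (v / 2) by ring, Real.cos_two_mul']
      ring
    rw [this]; push_cast; ring
  have hw2 : w ^ 2 = -(v : ℂ) ^ 2 := by rw [hwdef, mul_pow, I_sq]; ring
  have hvc : (v : ℂ) ≠ 0 := ofReal_ne_zero.2 hv
  have e : cexp (-w) = 2 * Real.cos v - cexp w := by rw [← hcos]; ring
  simp only [ofReal_neg, ofReal_one, ofReal_zero, mul_zero, Complex.exp_zero, mul_one, mul_neg, hw2,
    e, hcos2]
  push_cast
  field_simp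
  ring

/-- The Fejér kernel, normalised to take the value `1` at the origin. -/
noncomputable def fejer (v : ℝ) : ℝ := Real.sinc (v / 2) ^ 2

theorem fejer_nonneg (v : ℝ) : 0 ≤ fejer v := sq_nonneg _

theorem fejer_neg (v : ℝ) : fejer (-v) = fejer v := by
  rw [fejer, neg_div, Real.sinc_neg, fejer]

theorem continuous_fejer : Continuous fejer :=
  (Real.continuous_sinc.comp (continuous_id.div_const 2)).pow 2

theorem fejer_le (v : ℝ) : fejer v ≤ 5 * (1 + v ^ 2)⁻¹ := by
  rw [fejer, ← div_eq_mul_inv, le_div_iff₀ (by positivity)]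
  have h1 : Real.sinc (v / 2) ^ 2 ≤ 1 := by
    rw [← sq_abs]; exact pow_le_one₀ (abs_nonneg _) (Real.abs_sinc_le_one _)
  have h2 : Real.sinc (v / 2) ^ 2 * v ^ 2 ≤ 4 := by
    rcases eq_or_ne v 0 with rfl | hv
    · simp
    rw [Real.sinc_of_ne_zero (by positivity), div_pow, div_pow, div_div_eq_mul_div,
      div_mul_cancel₀ _ (by positivity)]
    nlinarith [Real.sin_sq_le_one (v / 2)]
  linarith

open MeasureTheory in
theorem integrable_fejer : Integrable fejer :=
  (integrable_inv_one_add_sq.const_mul 5).mono' continuous_fejer.aestronglyMeasurable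
    (Eventually.of_forall fun v => by
      rw [Real.norm_of_nonneg (fejer_nonneg _)]; exact fejer_le v)

open MeasureTheory in
theorem integral_fejer_pos : 0 < ∫ v : ℝ, fejer v :=
  integral_pos_of_integrable_nonneg_nonzero (x := 0) continuous_fejer integrable_fejer
    fejer_nonneg (by simp [fejer])

open MeasureTheory Set Complex in
theorem integral_triangle_mul_laplace {h : ℝ → ℝ} {g : ℂ → ℂ} {M : ℝ} (hm : Measurable h)
    (hM : ∀ u, |h u| ≤ M)
    (hgh : ∀ z : ℂ, 0 < z.re → ∫ u in Ioi (0 : ℝ), (h u : ℂ) * cexp (-z * u) = g z)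
    (lam y : ℝ) {ε : ℝ} (hε : 0 < ε) :
    ∫ t in Ioc (-1 : ℝ) 1, ((1 - |t| : ℝ) : ℂ) * cexp ((lam * y : ℝ) * t * I) *
        g (ε + (lam * t : ℝ) * I) =
      ((∫ u in Ioi (0 : ℝ), h u * Real.exp (-ε * u) * fejer (lam * (u - y)) : ℝ) : ℂ) := by
  have hFint : Integrable (Function.uncurry fun (t u : ℝ) =>
      ((1 - |t| : ℝ) : ℂ) * cexp ((lam * y : ℝ) * t * I) *
        ((h u : ℂ) * cexp (-(ε + (lam * t : ℝ) * I) * u)))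
      ((volume.restrict (Ioc (-1 : ℝ) 1)).prod (volume.restrict (Ioi (0 : ℝ)))) := by
    have hb : Integrable (fun p : ℝ × ℝ => (1 : ℝ) * (M * Real.exp (-ε * p.2)))
        ((volume.restrict (Ioc (-1 : ℝ) 1)).prod (volume.restrict (Ioi (0 : ℝ)))) :=
      Integrable.mul_prod (integrable_const (1 : ℝ))
        ((exp_neg_integrableOn_Ioi 0 hε).const_mul M)
    refine hb.mono' ?_ ?_
    · have hm2 : Measurable fun p : ℝ × ℝ => (h p.2 : ℂ) :=
        (measurable_ofReal.comp hm).comp measurable_snd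
      refine Measurable.aestronglyMeasurable ?_
      refine Measurable.mul (Continuous.measurable (by fun_prop)) (hm2.mul
        (Continuous.measurable (by fun_prop)))
    · rw [Measure.prod_restrict]
      refine (ae_restrict_iff' (measurableSet_Ioc.prod measurableSet_Ioi)).2
        (Eventually.of_forall ?_)
      rintro ⟨t, u⟩ ⟨ht, hu⟩
      simp only [Function.uncurry, norm_mul, Complex.norm_exp, norm_real]
      have e1 : ((lam * y : ℝ) * t * I : ℂ).re = 0 := by simp
      have e2 : (-((ε : ℂ) + (lam * t : ℝ) * I) * u).re = -ε * u := by simp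
      rw [e1, e2, Real.exp_zero, mul_one]
      refine mul_le_mul ?_ (mul_le_mul_of_nonneg_right (hM u) (Real.exp_pos _).le)
        (by positivity) zero_le_one
      have := abs_le.2 ⟨ht.1.le, ht.2⟩
      rw [Real.norm_of_nonneg (by linarith)]
      linarith [abs_nonneg t]
  have hswap := integral_integral_swap hFint
  have hleft : ∀ t : ℝ, ∫ u in Ioi (0 : ℝ), ((1 - |t| : ℝ) : ℂ) * cexp ((lam * y : ℝ) * t * I) *
        ((h u : ℂ) * cexp (-(ε + (lam * t : ℝ) * I) * u)) =
      ((1 - |t| : ℝ) : ℂ) * cexp ((lam * y : ℝ) * t * I) * g (ε + (lam * t : ℝ) * I) := fun t => by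
    rw [integral_const_mul, hgh _ (by simpa using hε)]
  simp only [hleft] at hswap
  rw [hswap, ← integral_complex_ofReal]
  refine integral_congr_ae (Eventually.of_forall fun u => ?_)
  have hK := integral_triangle_mul_cexp (-(lam * (u - y)))
  rw [intervalIntegral.integral_of_le (by norm_num)] at hK
  change _ = ((fejer (-(lam * (u - y))) : ℝ) : ℂ) at hK
  rw [fejer_neg] at hK
  simp only [ofReal_mul (_ * _) (fejer _), ← hK]
  rw [← integral_const_mul]
  refine integral_congr_ae (Eventually.of_forall fun t => ?_)
  have : cexp ((lam * y : ℝ) * t * I) * cexp (-(ε + (lam * t : ℝ) * I) * u) =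
      cexp ((-ε * u : ℝ)) * cexp ((-(lam * (u - y)) : ℝ) * t * I) := by
    rw [← Complex.exp_add, ← Complex.exp_add]
    congr 1
    push_cast
    ring
  simp only [ofReal_mul, ofReal_exp]
  calc _ = ((1 - |t| : ℝ) : ℂ) * h u * (cexp ((lam * y : ℝ) * t * I) *
      cexp (-(ε + (lam * t : ℝ) * I) * u)) := by push_cast; ring
    _ = _ := by rw [this]; push_cast; ring

open MeasureTheory Set Complex in
theorem integral_triangle_mul_boundary {h : ℝ → ℝ} {g : ℂ → ℂ} {M : ℝ} (hm : Measurable h)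
    (hM : ∀ u, |h u| ≤ M) (hg : ContinuousOn g {z | 0 ≤ z.re})
    (hgh : ∀ z : ℂ, 0 < z.re → ∫ u in Ioi (0 : ℝ), (h u : ℂ) * cexp (-z * u) = g z)
    {lam : ℝ} (hlam : 0 < lam) (y : ℝ) :
    ∫ t in Ioc (-1 : ℝ) 1, ((1 - |t| : ℝ) : ℂ) * cexp ((lam * y : ℝ) * t * I) *
        g ((lam * t : ℝ) * I) =
      ((∫ u in Ioi (0 : ℝ), h u * fejer (lam * (u - y)) : ℝ) : ℂ) := by
  have hM0 : 0 ≤ M := (abs_nonneg _).trans (hM 0)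
  have hKint : Integrable fun u : ℝ => fejer (lam * (u - y)) :=
    (integrable_fejer.comp_mul_left' hlam.ne').comp_sub_right y
  have hcontK : Continuous fun u : ℝ => fejer (lam * (u - y)) :=
    continuous_fejer.comp (by fun_prop)
  have hright : Tendsto (fun ε : ℝ => ((∫ u in Ioi (0 : ℝ), h u * Real.exp (-ε * u) *
      fejer (lam * (u - y)) : ℝ) : ℂ)) (nhdsWithin 0 (Ioi 0))
      (nhds ((∫ u in Ioi (0 : ℝ), h u * fejer (lam * (u - y)) : ℝ) : ℂ)) := by
    refine (continuous_ofReal.tendsto _).comp ?_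
    refine tendsto_integral_filter_of_dominated_convergence (fun u => M * fejer (lam * (u - y)))
      ?_ ?_ (hKint.const_mul M).integrableOn ?_
    · refine Eventually.of_forall fun ε => Measurable.aestronglyMeasurable ?_
      exact (hm.mul (Continuous.measurable (by fun_prop))).mul hcontK.measurable
    · filter_upwards [self_mem_nhdsWithin] with ε (hε : 0 < ε)
      refine (ae_restrict_iff' measurableSet_Ioi).2 (Eventually.of_forall fun u (hu : 0 < u) => ?_)
      rw [norm_mul, norm_mul, Real.norm_of_nonneg (fejer_nonneg _),
        Real.norm_of_nonneg (Real.exp_pos _).le]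
      refine mul_le_mul_of_nonneg_right ?_ (fejer_nonneg _)
      calc ‖h u‖ * Real.exp (-ε * u) ≤ M * 1 :=
            mul_le_mul (hM u) (Real.exp_le_one_iff.2 (by nlinarith)) (Real.exp_pos _).le hM0
        _ = M := mul_one M
    · refine Eventually.of_forall fun u => ?_
      have hc : Continuous fun ε : ℝ => h u * Real.exp (-ε * u) * fejer (lam * (u - y)) := by
        fun_prop
      have := hc.tendsto 0
      simp only [neg_zero, zero_mul, Real.exp_zero, mul_one] at this
      exact this.mono_left nhdsWithin_le_nhds
  have hleft : Tendsto (fun ε : ℝ => ∫ t in Ioc (-1 : ℝ) 1, ((1 - |t| : ℝ) : ℂ) *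
      cexp ((lam * y : ℝ) * t * I) * g (ε + (lam * t : ℝ) * I)) (nhdsWithin 0 (Ioi 0))
      (nhds (∫ t in Ioc (-1 : ℝ) 1, ((1 - |t| : ℝ) : ℂ) * cexp ((lam * y : ℝ) * t * I) *
        g ((lam * t : ℝ) * I))) := by
    have hΦ : Continuous fun p : ℝ × ℝ => ((p.1 : ℂ) + (lam * p.2 : ℝ) * I) := by fun_prop
    have hcomp : ContinuousOn (fun p : ℝ × ℝ => g ((p.1 : ℂ) + (lam * p.2 : ℝ) * I))
        {p | 0 ≤ p.1} := hg.comp hΦ.continuousOn fun p hp => by simpa using hp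
    obtain ⟨C, hC⟩ := ((isCompact_Icc (a := (0 : ℝ)) (b := 1)).prod
      (isCompact_Icc (a := (-1 : ℝ)) (b := 1))).exists_bound_of_continuousOn
      (hcomp.mono fun p hp => hp.1.1)
    refine tendsto_integral_filter_of_dominated_convergence (fun _ => C) ?_ ?_
      (integrable_const C) ?_
    · filter_upwards [self_mem_nhdsWithin] with ε (hε : 0 < ε)
      refine Continuous.aestronglyMeasurable (Continuous.mul (by fun_prop) ?_)
      exact continuousOn_univ.1 (hcomp.comp (f := fun t : ℝ => ((ε, t) : ℝ × ℝ))
        (by fun_prop) fun t _ => hε.le)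
    · filter_upwards [Ioc_mem_nhdsGT (zero_lt_one' ℝ)] with ε hε
      refine (ae_restrict_iff' measurableSet_Ioc).2 (Eventually.of_forall fun t ht => ?_)
      have hb := hC (ε, t) ⟨⟨hε.1.le, hε.2⟩, ⟨ht.1.le, ht.2⟩⟩
      have e1 : ((lam * y : ℝ) * t * I : ℂ).re = 0 := by simp
      rw [norm_mul, norm_mul, Complex.norm_exp, e1, Real.exp_zero, mul_one, norm_real]
      have := abs_le.2 ⟨ht.1.le, ht.2⟩
      rw [Real.norm_of_nonneg (by linarith)]
      calc (1 - |t|) * _ ≤ 1 * C :=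
            mul_le_mul (by linarith [abs_nonneg t]) hb (norm_nonneg _) zero_le_one
        _ = C := one_mul C
    · refine Eventually.of_forall fun t => Tendsto.const_mul _ ?_
      have h1 : Tendsto (fun ε : ℝ => ((ε, t) : ℝ × ℝ)) (nhdsWithin 0 (Ioi 0))
          (nhdsWithin (0, t) {p | 0 ≤ p.1}) := by
        refine tendsto_nhdsWithin_iff.2 ⟨?_, ?_⟩
        · exact ((by fun_prop : Continuous fun ε : ℝ => ((ε, t) : ℝ × ℝ)).tendsto 0).mono_left
            nhdsWithin_le_nhds
        · filter_upwards [self_mem_nhdsWithin] with ε hε using (le_of_lt hε : (0:ℝ) ≤ ε)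
      have h2 := (hcomp (0, t) (le_refl (0 : ℝ))).tendsto.comp h1
      simpa [Function.comp_def] using h2
  refine tendsto_nhds_unique (hleft.congr' ?_) hright
  filter_upwards [self_mem_nhdsWithin] with ε hε
  exact integral_triangle_mul_laplace hm hM hgh lam y hε

open MeasureTheory Set Complex in
/-- If the Laplace transform of a bounded function extends continuously to the closed right
half-plane, then the convolutions of this function with Fejér kernels tend to zero. -/
theorem tendsto_integral_mul_fejer {h : ℝ → ℝ} {g : ℂ → ℂ} {M : ℝ} (hm : Measurable h)
    (hM : ∀ u, |h u| ≤ M) (hg : ContinuousOn g {z | 0 ≤ z.re})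
    (hgh : ∀ z : ℂ, 0 < z.re → ∫ u in Ioi (0 : ℝ), (h u : ℂ) * cexp (-z * u) = g z)
    {lam : ℝ} (hlam : 0 < lam) :
    Tendsto (fun y => ∫ u in Ioi (0 : ℝ), h u * fejer (lam * (u - y))) atTop (nhds 0) := by
  have hRL := Real.tendsto_integral_exp_smul_cocompact
    ((Ioc (-1 : ℝ) 1).indicator fun t => ((1 - |t| : ℝ) : ℂ) * g ((lam * t : ℝ) * I))
  have hw : Tendsto (fun y : ℝ => (-(lam / (2 * Real.pi))) * y) atTop (cocompact ℝ) := by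
    refine Tendsto.mono_right ?_ atBot_le_cocompact
    exact tendsto_id.const_mul_atTop_of_neg (neg_neg_of_pos (by positivity))
  have h1 := hRL.comp hw
  rw [← tendsto_ofReal_iff, ofReal_zero]
  refine h1.congr fun y => ?_
  rw [← integral_triangle_mul_boundary hm hM hg hgh hlam y, ← integral_indicator measurableSet_Ioc]
  refine integral_congr_ae (Eventually.of_forall fun t => ?_)
  by_cases ht : t ∈ Ioc (-1 : ℝ) 1
  · simp only [indicator_of_mem ht, Circle.smul_def, Real.fourierChar_apply, smul_eq_mul]
    have : (2 * Real.pi * -(t * (-(lam / (2 * Real.pi)) * y)) : ℝ) = lam * y * t := by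
      field_simp
    rw [this]
    push_cast
    ring
  · simp only [indicator_of_notMem ht, smul_zero]

open MeasureTheory Set in
theorem tendsto_integral_comp_mul_fejer {B : ℝ → ℝ} {C : ℝ} (hm : Measurable B)
    (hC : ∀ u, |B u| ≤ C) (hB : ∀ u ≤ 0, B u = 0) {lam : ℝ} (hlam : 0 < lam)
    (hlim : Tendsto (fun y => ∫ u in Ioi (0 : ℝ), (B u - 1) * fejer (lam * (u - y))) atTop
      (nhds 0)) :
    Tendsto (fun y => ∫ v, B (y + v / lam) * fejer v) atTop (nhds (∫ v, fejer v)) := by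
  set H : ℝ → ℝ := (Ioi (0 : ℝ)).indicator fun u => B u - 1 with hH
  set J : ℝ → ℝ := (Ioi (0 : ℝ)).indicator fun _ => 1 with hJ
  have hBHJ : ∀ u, B u = H u + J u := fun u => by
    by_cases hu : u ∈ Ioi (0 : ℝ)
    · simp [hH, hJ, indicator_of_mem hu]
    · simp [hH, hJ, indicator_of_notMem hu, hB u (not_lt.1 hu)]
  have hHm : Measurable H := (hm.sub_const 1).indicator measurableSet_Ioi
  have hJm : Measurable J := measurable_const.indicator measurableSet_Ioi
  have hJb : ∀ u, |J u| ≤ 1 := fun u => by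
    by_cases hu : u ∈ Ioi (0 : ℝ)
    · simp [hJ, indicator_of_mem hu]
    · simp [hJ, indicator_of_notMem hu]
  have hHb : ∀ u, |H u| ≤ C + 1 := fun u => by
    rw [show H u = B u - J u by rw [hBHJ]; ring]
    exact (abs_sub _ _).trans (add_le_add (hC u) (hJb u))
  have hFint : ∀ {F : ℝ → ℝ} {D : ℝ} (y : ℝ), Measurable F → (∀ u, |F u| ≤ D) →
      Integrable fun v => F (y + v / lam) * fejer v := fun {F D} y hFm hF =>
    integrable_fejer.bdd_mul (c := D)
      (hFm.comp (by fun_prop : Measurable fun v : ℝ => y + v / lam)).aestronglyMeasurable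
      (Eventually.of_forall fun v => hF _)
  have hscale : ∀ y, ∫ v, H (y + v / lam) * fejer v =
      lam * ∫ u in Ioi (0 : ℝ), (B u - 1) * fejer (lam * (u - y)) := fun y => by
    have e1 : ∀ v, H (y + v / lam) * fejer v =
        (fun w => H (y + w) * fejer (lam * (y + w - y))) (v / lam) := fun v => by
      simp only [add_sub_cancel_left]
      rw [mul_div_cancel₀ _ hlam.ne']
    rw [integral_congr_ae (Eventually.of_forall e1),
      Measure.integral_comp_div (fun w => H (y + w) * fejer (lam * (y + w - y))) lam,
      abs_of_pos hlam, smul_eq_mul,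
      integral_add_left_eq_self (fun u => H u * fejer (lam * (u - y))) y,
      ← integral_indicator measurableSet_Ioi]
    congr 2
    ext u
    simp only [hH, indicator_mul_left]
  have h1 : Tendsto (fun y => ∫ v, H (y + v / lam) * fejer v) atTop (nhds 0) := by
    simp_rw [hscale]
    simpa using hlim.const_mul lam
  have h2 : Tendsto (fun y => ∫ v, J (y + v / lam) * fejer v) atTop (nhds (∫ v, fejer v)) := by
    refine tendsto_integral_filter_of_dominated_convergence fejer
      (Eventually.of_forall fun y => (hFint y hJm hJb).aestronglyMeasurable) ?_ integrable_fejer ?_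
    · refine Eventually.of_forall fun y => Eventually.of_forall fun v => ?_
      rw [norm_mul, Real.norm_of_nonneg (fejer_nonneg _)]
      exact mul_le_of_le_one_left (fejer_nonneg _) (hJb _)
    · refine Eventually.of_forall fun v => tendsto_const_nhds.congr' ?_
      filter_upwards [eventually_gt_atTop (-(v / lam))] with y hy
      rw [hJ, indicator_of_mem (show y + v / lam ∈ Ioi (0 : ℝ) from by simp only [mem_Ioi]; linarith),
        one_mul]
  have h3 := h1.add h2
  rw [zero_add] at h3
  refine h3.congr fun y => ?_
  rw [← integral_add (hFint y hHm hHb) (hFint y hJm hJb)]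
  refine integral_congr_ae (Eventually.of_forall fun v => ?_)
  simp only [hBHJ, add_mul]

open MeasureTheory Set in
/-- A Tauberian theorem: Fejér means control a function `B` for which `u ↦ exp u * B u` is
monotone. -/
theorem tendsto_one_of_tendsto_fejer {B : ℝ → ℝ} {C : ℝ} (hm : Measurable B)
    (hC : ∀ u, B u ≤ C) (hB0 : ∀ u, 0 ≤ B u) (hmono : Monotone fun u => Real.exp u * B u)
    (hlim : ∀ lam : ℝ, 0 < lam →
      Tendsto (fun y => ∫ v, B (y + v / lam) * fejer v) atTop (nhds (∫ v, fejer v))) :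
    Tendsto B atTop (nhds 1) := by
  set c := ∫ v, fejer v with hc
  have hcpos : 0 < c := integral_fejer_pos
  have hI : Tendsto (fun R : ℝ => ∫ v in (-R)..R, fejer v) atTop (nhds c) :=
    intervalIntegral_tendsto_integral integrable_fejer tendsto_neg_atTop_atBot tendsto_id
  have hFint : ∀ (y lam : ℝ), Integrable fun v => B (y + v / lam) * fejer v := fun y lam =>
    integrable_fejer.bdd_mul (c := C)
      (hm.comp (by fun_prop : Measurable fun v : ℝ => y + v / lam)).aestronglyMeasurable
      (Eventually.of_forall fun v => by rw [Real.norm_of_nonneg (hB0 _)]; exact hC _)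
  have hcomp : ∀ u w : ℝ, ∀ δ : ℝ, u ≤ w → w ≤ u + 2 * δ → B u ≤ B w * Real.exp (2 * δ) :=
    fun u w δ huw hwu => by
      have h1 : Real.exp u * B u ≤ Real.exp w * B w := hmono huw
      have h2 : Real.exp w ≤ Real.exp u * Real.exp (2 * δ) := by
        rw [← Real.exp_add]; exact Real.exp_le_exp.2 hwu
      have h3 := mul_le_mul_of_nonneg_right h2 (hB0 w)
      refine le_of_mul_le_mul_left (a := Real.exp u) ?_ (Real.exp_pos u)
      linarith
  have habs : ∀ {v R δ : ℝ}, 0 < R → 0 < δ → v ∈ Ioc (-R) R →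
      -δ ≤ v / (R / δ) ∧ v / (R / δ) ≤ δ := fun {v R δ} hR hδ hv => by
    rw [div_div_eq_mul_div, le_div_iff₀ hR, div_le_iff₀ hR]
    constructor <;> nlinarith [hv.1, hv.2]
  have hsub : ∀ {R : ℝ}, 0 < R → ∫ v in (-R)..R, fejer v = ∫ v in Ioc (-R) R, fejer v :=
    fun {R} hR => intervalIntegral.integral_of_le (by linarith)
  refine tendsto_order.2 ⟨fun a ha => ?_, fun a ha => ?_⟩
  · have h1 : Tendsto (fun R : ℝ => (c - C * (c - ∫ v in (-R)..R, fejer v)) /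
        ∫ v in (-R)..R, fejer v) atTop (nhds ((c - C * (c - c)) / c)) :=
      ((tendsto_const_nhds.sub hI).const_mul C).const_sub c |>.div hI hcpos.ne'
    rw [sub_self, mul_zero, sub_zero, div_self hcpos.ne'] at h1
    obtain ⟨R, ⟨hR, hIR⟩, hR0⟩ := (((h1.eventually_const_lt ha).and
      (hI.eventually_const_lt hcpos)).and (eventually_gt_atTop (0 : ℝ))).exists
    set I := ∫ v in (-R)..R, fejer v with hIdef
    have h2 : Tendsto (fun δ : ℝ => (c - C * (c - I)) / I / Real.exp (2 * δ))
        (nhdsWithin 0 (Ioi 0)) (nhds ((c - C * (c - I)) / I)) := by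
      have : Continuous fun δ : ℝ => (c - C * (c - I)) / I / Real.exp (2 * δ) :=
        continuous_const.div (by fun_prop) fun δ => (Real.exp_pos _).ne'
      have := this.tendsto 0
      simp only [mul_zero, Real.exp_zero, div_one] at this
      exact this.mono_left nhdsWithin_le_nhds
    obtain ⟨δ, hδ, hδ0⟩ := ((h2.eventually_const_lt hR).and
      (self_mem_nhdsWithin : ∀ᶠ δ in nhdsWithin (0 : ℝ) (Ioi 0), δ ∈ Ioi (0 : ℝ))).exists
    have hδ0' : 0 < δ := hδ0
    have h3 := ((((hlim (R / δ) (by positivity)).sub_const (C * (c - I))).div_const I).div_const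
      (Real.exp (2 * δ))).eventually_const_lt hδ
    have h4 := (tendsto_atTop_add_const_right atTop (-δ) tendsto_id).eventually h3
    filter_upwards [h4] with y hy
    refine hy.trans_le ?_
    simp only [id]
    rw [div_le_iff₀ (Real.exp_pos _), div_le_iff₀ hIR, sub_le_iff_le_add,
      ← integral_add_compl (measurableSet_Ioc (a := -R) (b := R)) (hFint _ _)]
    refine add_le_add ?_ ?_
    · rw [hIdef, hsub hR0, ← integral_const_mul]
      refine setIntegral_mono_on (hFint _ _).integrableOn
        (integrable_fejer.const_mul _).integrableOn measurableSet_Ioc fun v hv => ?_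
      have := habs hR0 hδ0' hv
      exact mul_le_mul_of_nonneg_right (hcomp _ _ _ (by linarith) (by linarith)) (fejer_nonneg _)
    · have : c - I = ∫ v in (Ioc (-R) R)ᶜ, fejer v := by
        rw [hIdef, hsub hR0, hc, ← integral_add_compl (measurableSet_Ioc (a := -R) (b := R))
          integrable_fejer]
        ring
      rw [this, ← integral_const_mul]
      exact setIntegral_mono (hFint _ _).integrableOn
        (integrable_fejer.const_mul _).integrableOn fun v =>
          mul_le_mul_of_nonneg_right (hC _) (fejer_nonneg _)
  · have h1 : Tendsto (fun R : ℝ => c / ∫ v in (-R)..R, fejer v) atTop (nhds (c / c)) :=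
      tendsto_const_nhds.div hI hcpos.ne'
    rw [div_self hcpos.ne'] at h1
    obtain ⟨R, ⟨hR, hIR⟩, hR0⟩ := (((h1.eventually_lt_const ha).and
      (hI.eventually_const_lt hcpos)).and (eventually_gt_atTop (0 : ℝ))).exists
    set I := ∫ v in (-R)..R, fejer v with hIdef
    have h2 : Tendsto (fun δ : ℝ => c / I * Real.exp (2 * δ))
        (nhdsWithin 0 (Ioi 0)) (nhds (c / I)) := by
      have : Continuous fun δ : ℝ => c / I * Real.exp (2 * δ) := by fun_prop
      have := this.tendsto 0
      simp only [mul_zero, Real.exp_zero, mul_one] at this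
      exact this.mono_left nhdsWithin_le_nhds
    obtain ⟨δ, hδ, hδ0⟩ := ((h2.eventually_lt_const hR).and
      (self_mem_nhdsWithin : ∀ᶠ δ in nhdsWithin (0 : ℝ) (Ioi 0), δ ∈ Ioi (0 : ℝ))).exists
    have hδ0' : 0 < δ := hδ0
    have h3 := (((hlim (R / δ) (by positivity)).div_const I).mul_const
      (Real.exp (2 * δ))).eventually_lt_const hδ
    have h4 := (tendsto_atTop_add_const_right atTop δ tendsto_id).eventually h3
    filter_upwards [h4] with y hy
    refine lt_of_le_of_lt ?_ hy
    simp only [id]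
    rw [div_mul_eq_mul_div, le_div_iff₀ hIR, ← integral_mul_const, hIdef, hsub hR0,
      ← integral_const_mul]
    refine le_trans (setIntegral_mono_on (integrable_fejer.const_mul _).integrableOn
      ((hFint _ _).mul_const _).integrableOn measurableSet_Ioc fun v hv => ?_)
      (setIntegral_le_integral ((hFint (y + δ) (R / δ)).mul_const (Real.exp (2 * δ)))
        (Eventually.of_forall fun v => ?_))
    · have := habs hR0 hδ0' hv
      have := mul_le_mul_of_nonneg_right (hcomp y (y + δ + v / (R / δ)) δ (by linarith)
        (by linarith)) (fejer_nonneg v)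
      linarith
    · exact mul_nonneg (mul_nonneg (hB0 _) (fejer_nonneg _)) (Real.exp_pos _).le

open ArithmeticFunction Complex MeasureTheory Set in
theorem LSeries_vonMangoldt_eq_mul_integral_psi {s : ℂ} (hs : 1 < s.re) :
    LSeries (fun n => (vonMangoldt n : ℂ)) s =
      s * ∫ t in Ioi (1 : ℝ), (Chebyshev.psi t : ℂ) * (t : ℂ) ^ (-(s + 1)) := by
  have hO : (fun n : ℕ => ∑ k ∈ Finset.Icc 1 n, vonMangoldt k) =O[atTop]
      fun n : ℕ => (n : ℝ) ^ (1 : ℝ) := by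
    refine Asymptotics.IsBigO.of_bound (Real.log 4 + 4) (Eventually.of_forall fun n => ?_)
    have h := Chebyshev.psi_le_const_mul_self (x := (n : ℝ)) (Nat.cast_nonneg n)
    rw [Chebyshev.psi, Nat.floor_natCast] at h
    rw [Real.rpow_one, Real.norm_of_nonneg (Finset.sum_nonneg fun _ _ => vonMangoldt_nonneg),
      Real.norm_of_nonneg (Nat.cast_nonneg n)]
    exact h
  rw [LSeries_eq_mul_integral_of_nonneg _ zero_le_one hs hO fun _ => vonMangoldt_nonneg]
  congr 1
  refine integral_congr_ae (Eventually.of_forall fun t => ?_)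
  simp only [Chebyshev.psi, ofReal_sum]
  rfl

open Complex MeasureTheory Set in
theorem integral_psi_exp_mul_cexp {s : ℂ} :
    ∫ u in Ioi (0 : ℝ), ((Chebyshev.psi (Real.exp u) * Real.exp (-u) : ℝ) : ℂ) *
        cexp (-(s - 1) * u) =
      ∫ t in Ioi (1 : ℝ), (Chebyshev.psi t : ℂ) * (t : ℂ) ^ (-(s + 1)) := by
  rw [← Real.exp_zero, ← integral_comp_exp_Ioi]
  refine integral_congr_ae (Eventually.of_forall fun u => ?_)
  have : ((Real.exp u : ℝ) : ℂ) ^ (-(s + 1)) = cexp (u * (-(s + 1))) := by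
    rw [cpow_def_of_ne_zero (ofReal_ne_zero.2 (Real.exp_pos u).ne'), ← ofReal_log (Real.exp_pos u).le,
      Real.log_exp]
  simp only [this, real_smul]
  simp only [ofReal_mul, ofReal_exp]
  rw [mul_assoc, ← Complex.exp_add, mul_left_comm, ← Complex.exp_add]
  congr 2
  push_cast
  ring

/-- The continuous extension to `1 ≤ s.re` of `∑ Λ(n) n⁻ˢ - 1 / (s - 1)`. -/
theorem exists_continuousOn_LSeries_vonMangoldt_sub :
    ∃ F : ℂ → ℂ, ContinuousOn F {s | 1 ≤ s.re} ∧ ∀ s : ℂ, 1 < s.re →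
      F s = LSeries (fun n => (ArithmeticFunction.vonMangoldt n : ℂ)) s - 1 / (s - 1) := by
  refine ⟨_, ArithmeticFunction.vonMangoldt.continuousOn_LFunctionResidueClassAux (1 : ZMod 1),
    fun s hs => ?_⟩
  rw [ArithmeticFunction.vonMangoldt.eqOn_LFunctionResidueClassAux isUnit_one hs]
  have : ∀ n, ArithmeticFunction.vonMangoldt.residueClass (1 : ZMod 1) n =
      ArithmeticFunction.vonMangoldt n := fun n =>
    Set.indicator_of_mem (s := {n : ℕ | (n : ZMod 1) = 1})
      (show (n : ZMod 1) = 1 from Subsingleton.elim _ _) _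
  simp [this]

open Complex MeasureTheory Set in
theorem tendsto_psi_exp_mul_exp_neg :
    Tendsto (fun u : ℝ => Chebyshev.psi (Real.exp u) * Real.exp (-u)) atTop (nhds 1) := by
  obtain ⟨F, hF, hFs⟩ := exists_continuousOn_LSeries_vonMangoldt_sub
  set B : ℝ → ℝ := fun u => Chebyshev.psi (Real.exp u) * Real.exp (-u) with hBdef
  have hm : Measurable B := (Chebyshev.psi_mono.measurable.comp Real.measurable_exp).mul
    (Real.measurable_exp.comp measurable_neg)
  have hB0 : ∀ u, 0 ≤ B u := fun u => mul_nonneg (Chebyshev.psi_nonneg _) (Real.exp_pos _).le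
  have hC : ∀ u, B u ≤ Real.log 4 + 4 := fun u => by
    have := mul_le_mul_of_nonneg_right
      (Chebyshev.psi_le_const_mul_self (Real.exp_pos u).le) (Real.exp_pos (-u)).le
    rwa [mul_assoc, ← Real.exp_add, add_neg_cancel, Real.exp_zero, mul_one] at this
  have habs : ∀ u, |B u| ≤ Real.log 4 + 4 := fun u => by rw [abs_of_nonneg (hB0 u)]; exact hC u
  have hneg : ∀ u ≤ 0, B u = 0 := fun u hu => by
    simp only [hBdef, Chebyshev.psi_eq_zero_of_le_one (Real.exp_le_one_iff.2 hu), zero_mul]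
  have hmono : Monotone fun u => Real.exp u * B u := by
    have : (fun u => Real.exp u * B u) = fun u => Chebyshev.psi (Real.exp u) := by
      ext u
      simp only [hBdef]
      rw [mul_left_comm, ← Real.exp_add, add_neg_cancel, Real.exp_zero, mul_one]
    rw [this]
    exact Chebyshev.psi_mono.comp Real.exp_monotone
  have hg : ContinuousOn (fun z : ℂ => (F (1 + z) - 1) / (1 + z)) {z | 0 ≤ z.re} := by
    have h1 : ContinuousOn (fun z : ℂ => F (1 + z)) {z | 0 ≤ z.re} :=
      hF.comp (by fun_prop) fun z hz => by
        simp only [mem_ofPred_eq, add_re, one_re] at hz ⊢; linarith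
    refine (h1.sub continuousOn_const).div (by fun_prop) fun z hz h0 => ?_
    have := congrArg re h0
    simp only [mem_ofPred_eq, add_re, one_re, zero_re] at hz this
    linarith
  have hgh : ∀ z : ℂ, 0 < z.re → ∫ u in Ioi (0 : ℝ), ((B u - 1 : ℝ) : ℂ) * cexp (-z * u) =
      (F (1 + z) - 1) / (1 + z) := fun z hz => by
    have hz0 : z ≠ 0 := fun h => by simp [h] at hz
    have hz1 : 1 + z ≠ 0 := fun h => by
      have := congrArg re h
      simp only [add_re, one_re, zero_re] at this
      linarith
    have he : IntegrableOn (fun u : ℝ => cexp (-z * u)) (Ioi 0) :=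
      integrableOn_exp_mul_complex_Ioi (by simpa using hz) 0
    have heB : IntegrableOn (fun u : ℝ => (B u : ℂ) * cexp (-z * u)) (Ioi 0) :=
      he.bdd_mul (c := Real.log 4 + 4) (measurable_ofReal.comp hm).aestronglyMeasurable
        (Eventually.of_forall fun u => by rw [norm_real]; exact habs u)
    simp only [ofReal_sub, ofReal_one, sub_mul, one_mul]
    rw [integral_sub heB he, integral_exp_mul_complex_Ioi (by simpa using hz)]
    have h1 := integral_psi_exp_mul_cexp (s := 1 + z)
    simp only [add_sub_cancel_left] at h1
    have hs : 1 < (1 + z).re := by simp [hz]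
    have h2 := LSeries_vonMangoldt_eq_mul_integral_psi hs
    rw [← h1] at h2
    rw [hFs _ hs, h2]
    simp only [hBdef, add_sub_cancel_left, ofReal_zero, mul_zero, Complex.exp_zero]
    field_simp
    ring
  refine tendsto_one_of_tendsto_fejer hm hC hB0 hmono fun lam hlam => ?_
  exact tendsto_integral_comp_mul_fejer hm habs hneg hlam
    (tendsto_integral_mul_fejer (M := Real.log 4 + 4 + 1) (hm.sub_const 1)
      (fun u => (abs_sub _ _).trans (by simpa using habs u)) hg hgh hlam)

/-- The **prime number theorem**, in terms of the Chebyshev function `ψ`. -/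
theorem tendsto_psi_div_self : Tendsto (fun x : ℝ => Chebyshev.psi x / x) atTop (nhds 1) := by
  refine (tendsto_psi_exp_mul_exp_neg.comp Real.tendsto_log_atTop).congr' ?_
  filter_upwards [eventually_gt_atTop 0] with x hx
  simp only [Function.comp]
  rw [Real.exp_neg, Real.exp_log hx, div_eq_mul_inv]

theorem div_le_sum_div_add {ι : Type*} [Fintype ι] [Nonempty ι] (f : ι → ℕ) {q : ℕ} (hq : 0 < q) :
    (∑ i, f i) / q ≤ ∑ i, f i / q + (Fintype.card ι - 1) := by
  have hc : 0 < Fintype.card ι := Fintype.card_pos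
  suffices h : (∑ i, f i) / q < ∑ i, f i / q + Fintype.card ι by omega
  rw [Nat.div_lt_iff_lt_mul hq, add_mul, Finset.sum_mul, ← Finset.card_univ, Finset.card_eq_sum_ones,
    Finset.sum_mul, ← Finset.sum_add_distrib]
  refine Finset.sum_lt_sum_of_nonempty Finset.univ_nonempty fun i _ => ?_
  have := Nat.lt_div_mul_add (a := f i) hq
  omega

theorem sum_div_le_sum_div {ι : Type*} (s : Finset ι) (f : ι → ℕ) (q : ℕ) :
    ∑ i ∈ s, f i / q ≤ (∑ i ∈ s, f i) / q := by
  rcases Nat.eq_zero_or_pos q with rfl | hq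
  · simp
  rw [Nat.le_div_iff_mul_le hq, Finset.sum_mul]
  exact Finset.sum_le_sum fun i _ => Nat.div_mul_le_self _ _

theorem factorization_multinomial_add {n ℓ p b : ℕ} (hp : p.Prime) (f : Fin n → ℕ)
    (hf : ∑ i, f i = ℓ) (hb : p.log ℓ < b) :
    (Nat.multinomial Finset.univ f).factorization p + ∑ k ∈ Finset.Ico 1 b, ∑ i, f i / p ^ k =
      ∑ k ∈ Finset.Ico 1 b, ℓ / p ^ k := by
  have h := congrArg (fun m => m.factorization p) (Nat.multinomial_spec Finset.univ f)
  simp only [hf] at h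
  rw [Nat.factorization_mul (Finset.prod_ne_zero_iff.2 fun i _ => Nat.factorial_ne_zero _)
    (Nat.multinomial_pos _ _).ne', Nat.factorization_prod fun i _ => Nat.factorial_ne_zero _,
    Finsupp.add_apply, Finsupp.finsetSum_apply, Nat.factorization_factorial hp hb] at h
  rw [← h, add_comm, Finset.sum_comm]
  congr 1
  refine Finset.sum_congr rfl fun i _ => (Nat.factorization_factorial hp ?_).symm
  refine lt_of_le_of_lt (Nat.log_mono_right ?_) hb
  rw [← hf]
  exact Finset.single_le_sum (fun _ _ => Nat.zero_le _) (Finset.mem_univ i)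

theorem min_div_eq_sum (ℓ q m : ℕ) (hq : 0 < q) :
    min (ℓ / q) m = ∑ j ∈ Finset.Icc 1 m, if q ≤ ℓ / j then 1 else 0 := by
  rw [← Finset.card_filter]
  have : (Finset.Icc 1 m).filter (fun j => q ≤ ℓ / j) = Finset.Icc 1 (min (ℓ / q) m) := by
    ext j
    simp only [Finset.mem_filter, Finset.mem_Icc, le_min_iff]
    constructor
    · rintro ⟨⟨h1, h2⟩, h3⟩
      rw [Nat.le_div_iff_mul_le (by omega)] at h3
      exact ⟨h1, (Nat.le_div_iff_mul_le hq).2 (by linarith), h2⟩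
    · rintro ⟨h1, h2, h3⟩
      rw [Nat.le_div_iff_mul_le hq] at h2
      exact ⟨⟨h1, h3⟩, (Nat.le_div_iff_mul_le (by omega)).2 (by linarith)⟩
  rw [this]; simp

theorem log_eq_sum {p m b : ℕ} (hp : 1 < p) (hb : p.log m < b) :
    p.log m = ∑ k ∈ Finset.Ico 1 b, if p ^ k ≤ m then 1 else 0 := by
  rw [← Finset.card_filter]
  have : (Finset.Ico 1 b).filter (fun k => p ^ k ≤ m) = Finset.Icc 1 (p.log m) := by
    ext k
    simp only [Finset.mem_filter, Finset.mem_Icc, Finset.mem_Ico]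
    constructor
    · rintro ⟨⟨h1, h2⟩, h3⟩
      exact ⟨h1, Nat.le_log_of_pow_le hp h3⟩
    · rintro ⟨h1, h2⟩
      have hm : m ≠ 0 := by rintro rfl; simp at h2; omega
      exact ⟨⟨h1, by omega⟩, Nat.pow_le_of_le_log hm h2⟩
  rw [this]; simp

theorem multinomial_dvd_prod_lcmUpto {n ℓ : ℕ} (hn : 1 ≤ n) (f : Fin n → ℕ) (hf : ∑ i, f i = ℓ) :
    Nat.multinomial Finset.univ f ∣ ∏ j ∈ Finset.Icc 1 (n - 1), Nat.lcmUpto (ℓ / j) := by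
  have : NeZero n := ⟨by omega⟩
  have hne : ∀ j ∈ Finset.Icc 1 (n - 1), Nat.lcmUpto (ℓ / j) ≠ 0 :=
    fun j _ => Nat.lcmUpto_ne_zero _
  rw [← Nat.factorization_prime_le_iff_dvd (Nat.multinomial_pos _ _).ne'
    (Finset.prod_ne_zero_iff.2 hne)]
  intro p hp
  rw [Nat.factorization_prod hne, Finsupp.finsetSum_apply]
  have hb : p.log ℓ < p.log ℓ + 1 := Nat.lt_succ_self _
  have hlog : ∀ j ∈ Finset.Icc 1 (n - 1), (Nat.lcmUpto (ℓ / j)).factorization p =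
      ∑ k ∈ Finset.Ico 1 (p.log ℓ + 1), if p ^ k ≤ ℓ / j then 1 else 0 := fun j _ => by
    rw [Nat.factorization_lcmUpto _ hp]
    exact log_eq_sum hp.one_lt
      (lt_of_le_of_lt (Nat.log_mono_right (Nat.div_le_self _ _)) hb)
  rw [Finset.sum_congr rfl hlog, Finset.sum_comm]
  have hpk : ∀ k, 0 < p ^ k := fun k => pow_pos hp.pos k
  simp_rw [← min_div_eq_sum ℓ _ (n - 1) (hpk _)]
  refine Nat.le_of_add_le_add_right (b := ∑ k ∈ Finset.Ico 1 (p.log ℓ + 1), ∑ i, f i / p ^ k) ?_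
  rw [factorization_multinomial_add hp f hf hb, ← Finset.sum_add_distrib]
  refine Finset.sum_le_sum fun k _ => ?_
  have := div_le_sum_div_add f (hpk k)
  rw [hf, Fintype.card_fin] at this
  omega

theorem le_factorization_multinomial {n ℓ p m : ℕ} (hp : p.Prime) (f : Fin n → ℕ)
    (hf : ∑ i, f i = ℓ) (hm : ∑ i, f i / p + m ≤ ℓ / p) :
    m ≤ (Nat.multinomial Finset.univ f).factorization p := by
  have h := factorization_multinomial_add hp f hf (b := p.log ℓ + 2) (by omega)
  have split : ∀ g : ℕ → ℕ, ∑ k ∈ Finset.Ico 1 (p.log ℓ + 2), g k =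
      g 1 + ∑ k ∈ Finset.Ico (1 + 1) (p.log ℓ + 2), g k := fun g =>
    Finset.sum_eq_sum_Ico_succ_bot (by omega) g
  rw [split, split] at h
  have h2 : ∑ k ∈ Finset.Ico (1 + 1) (p.log ℓ + 2), ∑ i, f i / p ^ k ≤
      ∑ k ∈ Finset.Ico (1 + 1) (p.log ℓ + 2), ℓ / p ^ k :=
    Finset.sum_le_sum fun k _ => hf ▸ sum_div_le_sum_div _ f _
  simp only [pow_one] at h
  omega

/-- A tuple witnessing that the bound `min (ℓ / p) (n - 1)` is attained at non-exceptional primes. -/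
theorem exists_tuple {n ℓ p : ℕ} (hp : p.Prime) (hn : 1 ≤ n)
    (hdvd : ∀ i ∈ Finset.Icc 1 (n - 1), ¬ p ∣ ℓ + i) :
    ∃ f : Fin n → ℕ, ∑ i, f i = ℓ ∧ ∑ i, f i / p + min (ℓ / p) (n - 1) ≤ ℓ / p := by
  obtain ⟨N, rfl⟩ : ∃ N, n = N + 1 := ⟨n - 1, by omega⟩
  simp only [Nat.add_sub_cancel] at *
  set m := min (ℓ / p) N with hm
  have hmN : m ≤ N := min_le_right _ _
  have hma : m ≤ ℓ / p := min_le_left _ _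
  have hp0 := hp.pos
  have hdm := Nat.div_add_mod ℓ p
  have hr : ℓ % p + N < p := by
    by_contra hcon
    have hlt := Nat.mod_lt ℓ hp0
    refine hdvd (p - ℓ % p) (Finset.mem_Icc.2 ⟨by omega, by omega⟩) ⟨ℓ / p + 1, ?_⟩
    rw [mul_add]; omega
  obtain ⟨c, hc⟩ := Nat.exists_eq_add_of_le hma
  have hlast : ℓ = m * (p - 1) + (p * c + (ℓ % p + m)) := by
    obtain ⟨P, rfl⟩ : ∃ P, p = P + 1 := ⟨p - 1, by omega⟩
    rw [hc] at hdm
    simp only [Nat.add_sub_cancel]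
    linarith
  have hcard : (Finset.univ.filter (fun i : Fin N => (i : ℕ) < m)).card = m := by
    rw [Fin.card_filter_val_lt]; omega
  refine ⟨Fin.cons (p * c + (ℓ % p + m)) (fun i : Fin N => if (i : ℕ) < m then p - 1 else 0),
    ?_, ?_⟩
  · rw [Fin.sum_univ_succ]
    simp only [Fin.cons_zero, Fin.cons_succ]
    rw [← Finset.sum_filter, Finset.sum_const, hcard, smul_eq_mul]
    omega
  · rw [Fin.sum_univ_succ]
    simp only [Fin.cons_zero, Fin.cons_succ]
    have h0 : ∀ i : Fin N, (if (i : ℕ) < m then p - 1 else 0) / p = 0 := fun i =>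
      Nat.div_eq_of_lt (by split_ifs <;> omega)
    simp only [h0, Finset.sum_const_zero, add_zero]
    rw [Nat.mul_add_div hp0, Nat.div_eq_of_lt (by omega), hc]
    omega

theorem multinomialLcm_ne_zero (n ℓ : ℕ) : multinomialLcm n ℓ ≠ 0 := by
  rw [multinomialLcm, Ne, Finset.lcm_eq_zero_iff]
  rintro ⟨f, -, hf⟩
  exact (Nat.multinomial_pos _ _).ne' hf

theorem multinomialLcm_dvd_prod_lcmUpto {n ℓ : ℕ} (hn : 1 ≤ n) :
    multinomialLcm n ℓ ∣ ∏ j ∈ Finset.Icc 1 (n - 1), Nat.lcmUpto (ℓ / j) :=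
  Finset.lcm_dvd fun f hf =>
    multinomial_dvd_prod_lcmUpto hn f (Finset.Nat.mem_antidiagonalTuple.1 hf)

theorem factorization_primorial {p m : ℕ} (hp : p.Prime) :
    (primorial m).factorization p = if p ≤ m then 1 else 0 := by
  rw [primorial, Nat.factorization_prod_apply fun q hq => (Finset.mem_filter.1 hq).2.ne_zero]
  have : ∀ q ∈ (Finset.range (m + 1)).filter Nat.Prime,
      q.factorization p = if p = q then 1 else 0 := fun q hq => by
    rw [(Finset.mem_filter.1 hq).2.factorization, Finsupp.single_apply]
    simp [eq_comm]
  rw [Finset.sum_congr rfl this, Finset.sum_ite_eq]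
  simp [hp]

theorem prod_primorial_dvd {n ℓ : ℕ} (hn : 1 ≤ n) :
    ∏ j ∈ Finset.Icc 1 (n - 1), primorial (ℓ / j) ∣
      multinomialLcm n ℓ * ∏ i ∈ Finset.Icc 1 (n - 1), (ℓ + i) ^ (n - 1) := by
  have hne : ∀ j ∈ Finset.Icc 1 (n - 1), primorial (ℓ / j) ≠ 0 := fun j _ => (primorial_pos _).ne'
  have hne' : ∀ i ∈ Finset.Icc 1 (n - 1), (ℓ + i) ^ (n - 1) ≠ 0 := fun i hi =>
    pow_ne_zero _ (by have := Finset.mem_Icc.1 hi; omega)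
  rw [← Nat.factorization_prime_le_iff_dvd (Finset.prod_ne_zero_iff.2 hne)
    (mul_ne_zero (multinomialLcm_ne_zero _ _) (Finset.prod_ne_zero_iff.2 hne'))]
  intro p hp
  rw [Nat.factorization_prod_apply hne, Finset.sum_congr rfl fun j _ => factorization_primorial hp,
    ← min_div_eq_sum ℓ p (n - 1) hp.pos, Nat.factorization_mul (multinomialLcm_ne_zero _ _)
      (Finset.prod_ne_zero_iff.2 hne'), Finsupp.add_apply, Nat.factorization_prod_apply hne']
  by_cases hdvd : ∀ i ∈ Finset.Icc 1 (n - 1), ¬ p ∣ ℓ + i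
  · obtain ⟨f, hf, hfm⟩ := exists_tuple hp hn hdvd
    have h1 := le_factorization_multinomial hp f hf hfm
    have h2 : Nat.multinomial Finset.univ f ∣ multinomialLcm n ℓ :=
      Finset.dvd_lcm (f := fun i => Nat.multinomial Finset.univ i)
        (Finset.Nat.mem_antidiagonalTuple.2 hf)
    have h3 := (Nat.factorization_le_iff_dvd (Nat.multinomial_pos _ _).ne'
      (multinomialLcm_ne_zero _ _)).2 h2 p
    omega
  · push Not at hdvd
    obtain ⟨i, hi, hpi⟩ := hdvd
    have h1 := Finset.single_le_sum (f := fun i => ((ℓ + i) ^ (n - 1)).factorization p)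
      (fun _ _ => Nat.zero_le _) hi
    have h2 : 1 ≤ (ℓ + i).factorization p :=
      (hp.dvd_iff_one_le_factorization (by have := Finset.mem_Icc.1 hi; omega)).1 hpi
    simp only [Nat.factorization_pow, Finsupp.smul_apply, smul_eq_mul] at h1 ⊢
    have h3 : n - 1 ≤ (n - 1) * (ℓ + i).factorization p := Nat.le_mul_of_pos_right _ h2
    omega

open Chebyshev in
theorem log_multinomialLcm_le {n : ℕ} (hn : 1 ≤ n) (ℓ : ℕ) :
    Real.log (multinomialLcm n ℓ) ≤ ∑ j ∈ Finset.Icc 1 (n - 1), psi ((ℓ : ℝ) / j) := by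
  have hle := Nat.le_of_dvd (Finset.prod_pos fun j _ => Nat.lcmUpto_pos _)
    (multinomialLcm_dvd_prod_lcmUpto (ℓ := ℓ) hn)
  have h1 : (0 : ℝ) < multinomialLcm n ℓ :=
    Nat.cast_pos.2 (Nat.pos_of_ne_zero (multinomialLcm_ne_zero _ _))
  refine (Real.log_le_log h1 (Nat.cast_le.2 hle)).trans_eq ?_
  rw [Nat.cast_prod, Real.log_prod fun j _ => Nat.cast_ne_zero.2 (Nat.lcmUpto_ne_zero _)]
  refine Finset.sum_congr rfl fun j _ => ?_
  rw [← psi_eq_log_lcmUpto, psi_eq_psi_coe_floor (_ / _), Nat.floor_div_eq_div]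

open Chebyshev in
theorem sum_theta_le_log_multinomialLcm {n : ℕ} (hn : 1 ≤ n) (ℓ : ℕ) :
    ∑ j ∈ Finset.Icc 1 (n - 1), theta ((ℓ : ℝ) / j) ≤ Real.log (multinomialLcm n ℓ) +
      ∑ i ∈ Finset.Icc 1 (n - 1), (n - 1 : ℕ) * Real.log ((ℓ : ℝ) + i) := by
  have hpos : ∀ i ∈ Finset.Icc 1 (n - 1), (ℓ + i) ^ (n - 1) ≠ 0 := fun i hi =>
    pow_ne_zero _ (by have := Finset.mem_Icc.1 hi; omega)
  have hL := multinomialLcm_ne_zero n ℓ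
  have hle := Nat.le_of_dvd (Nat.pos_of_ne_zero (mul_ne_zero hL (Finset.prod_ne_zero_iff.2 hpos)))
    (prod_primorial_dvd (ℓ := ℓ) hn)
  have h1 := Real.log_le_log
    (Nat.cast_pos.2 (Finset.prod_pos fun j _ => primorial_pos _)) (Nat.cast_le.2 hle)
  rw [Nat.cast_mul, Real.log_mul (Nat.cast_ne_zero.2 hL)
    (Nat.cast_ne_zero.2 (Finset.prod_ne_zero_iff.2 hpos)), Nat.cast_prod, Nat.cast_prod,
    Real.log_prod fun j _ => Nat.cast_ne_zero.2 (primorial_pos _).ne',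
    Real.log_prod fun i hi => Nat.cast_ne_zero.2 (hpos i hi)] at h1
  convert! h1 using 2
  · rename_i j hj
    rw [theta_eq_log_primorial, Nat.floor_div_eq_div]
  · refine Finset.sum_congr rfl fun i _ => ?_
    rw [Nat.cast_pow, Real.log_pow, Nat.cast_add]

open Chebyshev in
theorem tendsto_theta_div_of_psi (h : Tendsto (fun x : ℝ => psi x / x) atTop (nhds 1)) :
    Tendsto (fun x : ℝ => theta x / x) atTop (nhds 1) := by
  have h0 : (fun x : ℝ => (psi - theta) x / x) =O[atTop] fun x : ℝ => x ^ (-(1 / 2) : ℝ) := by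
    refine (isBigO_psi_sub_theta_sqrt.mul (Asymptotics.isBigO_refl (fun x : ℝ => x⁻¹) atTop)).congr'
      (Eventually.of_forall fun x => (div_eq_mul_inv _ _).symm) ?_
    filter_upwards [eventually_gt_atTop 0] with x hx
    rw [Real.sqrt_eq_rpow, ← Real.rpow_neg_one, ← Real.rpow_add hx]
    norm_num
  have h1 := h.sub (h0.trans_tendsto (tendsto_rpow_neg_atTop (by norm_num)))
  rw [sub_zero] at h1
  refine h1.congr fun x => ?_
  simp only [Pi.sub_apply]; ring

theorem tendsto_div_nat_div {F : ℝ → ℝ} (h : Tendsto (fun x : ℝ => F x / x) atTop (nhds 1))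
    {j : ℕ} (hj : 1 ≤ j) :
    Tendsto (fun ℓ : ℕ => F ((ℓ : ℝ) / j) / ℓ) atTop (nhds ((1 : ℝ) / j)) := by
  have hj' : (0 : ℝ) < j := by exact_mod_cast hj
  have h1 : Tendsto (fun ℓ : ℕ => (ℓ : ℝ) / j) atTop atTop :=
    tendsto_natCast_atTop_atTop.atTop_div_const hj'
  have h2 := (h.comp h1).div_const (j : ℝ)
  refine h2.congr fun ℓ => ?_
  simp only [Function.comp]
  field_simp

theorem tendsto_log_add_div (i : ℕ) :
    Tendsto (fun ℓ : ℕ => Real.log ((ℓ : ℝ) + i) / ℓ) atTop (nhds 0) := by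
  have h1 : (fun ℓ : ℕ => Real.log ((ℓ : ℝ) + i)) =o[atTop] fun ℓ : ℕ => (ℓ : ℝ) + i :=
    Real.isLittleO_log_id_atTop.comp_tendsto
      (tendsto_atTop_add_const_right _ (i : ℝ) tendsto_natCast_atTop_atTop)
  have h2 : (fun ℓ : ℕ => (ℓ : ℝ) + i) =O[atTop] fun ℓ : ℕ => (ℓ : ℝ) := by
    refine Asymptotics.IsBigO.of_bound 2 ?_
    filter_upwards [eventually_ge_atTop i] with ℓ hℓ
    have : (i : ℝ) ≤ ℓ := by exact_mod_cast hℓ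
    rw [Real.norm_of_nonneg (by positivity), Real.norm_of_nonneg (by positivity)]
    linarith
  exact (h1.trans_isBigO h2).tendsto_div_nhds_zero

/-- Fix `n ≥ 1`.  As `ℓ → ∞`, `log p(n,ℓ) = ℓ·H_{n-1} + o(ℓ)`, i.e.
`(log p(n,ℓ))/ℓ → H_{n-1} = ∑_{j=1}^{n-1} 1/j`. -/
theorem tendsto_log_multinomialLcm_div (n : ℕ) (hn : 1 ≤ n) :
    Tendsto (fun ℓ : ℕ => Real.log (multinomialLcm n ℓ) / (ℓ : ℝ)) atTop
      (nhds (∑ j ∈ Finset.Icc 1 (n - 1), (1 : ℝ) / j)) := by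
  have hup : Tendsto (fun ℓ : ℕ => ∑ j ∈ Finset.Icc 1 (n - 1), Chebyshev.psi ((ℓ : ℝ) / j) / ℓ) atTop
      (nhds (∑ j ∈ Finset.Icc 1 (n - 1), (1 : ℝ) / j)) :=
    tendsto_finsetSum _ fun j hj => tendsto_div_nat_div tendsto_psi_div_self (Finset.mem_Icc.1 hj).1
  have hlow : Tendsto (fun ℓ : ℕ => ∑ j ∈ Finset.Icc 1 (n - 1), Chebyshev.theta ((ℓ : ℝ) / j) / ℓ -
      ∑ i ∈ Finset.Icc 1 (n - 1), (n - 1 : ℕ) * (Real.log ((ℓ : ℝ) + i) / ℓ)) atTop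
      (nhds (∑ j ∈ Finset.Icc 1 (n - 1), (1 : ℝ) / j)) := by
    have h1 : Tendsto _ atTop (nhds _) := tendsto_finsetSum (Finset.Icc 1 (n - 1)) fun j hj =>
      tendsto_div_nat_div (tendsto_theta_div_of_psi tendsto_psi_div_self) (Finset.mem_Icc.1 hj).1
    have h2 : Tendsto _ atTop (nhds _) := tendsto_finsetSum (Finset.Icc 1 (n - 1)) fun i _ =>
      (tendsto_log_add_div i).const_mul ((n - 1 : ℕ) : ℝ)
    simpa using h1.sub h2
  refine tendsto_of_tendsto_of_tendsto_of_le_of_le hlow hup (fun ℓ => ?_) fun ℓ => ?_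
  · simp only [← Finset.sum_div, ← mul_div_assoc, ← sub_div]
    exact div_le_div_of_nonneg_right
      (sub_le_iff_le_add.2 (sum_theta_le_log_multinomialLcm hn ℓ)) (Nat.cast_nonneg _)
  · simp only [← Finset.sum_div]
    exact div_le_div_of_nonneg_right (log_multinomialLcm_le hn ℓ) (Nat.cast_nonneg _)
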